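/- Let f = a·z_1³ + b·z_2³ + c·z_3³ + 6d·z_1z_2z_3 be a nondegenerate ternary cubic. Define A_4(f) := abcd − d⁴, A_6(f) := a²b²c² − 20abcd³ − 8d⁶, Δ(f) := A_6(f)² + 64·A_4(f)³, P(f) := −d·(bc·e_1³ + ac·e_2³ + ab·e_3³) − (abc − 4d³)·e_1e_2e_3, and Q(f) := (abc − 10d³)·(bc·e_1³ + ac·e_2³ + ab·e_3³) − 6d²·(5abc + 4d³)·e_1e_2e_3. Then, with 𝐟 the associated form of f, the following identity holds in ℂ[e_1,e_2,e_3]: Δ(f)·𝐟 = −(1/36)·A_6(f)·P(f) − (1/27)·A_4(f)·Q(f). -/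

import Mathlib

open MvPolynomial

noncomputable section

/-- The gradient ideal `(f_{z_1},…,f_{z_n})` of a form `f`. -/
def gradIdeal (n : ℕ) (f : MvPolynomial (Fin n) ℂ) : Ideal (MvPolynomial (Fin n) ℂ) :=
  Ideal.span (Set.range fun i => pderiv i f)

/-- The Hessian `det (∂²f/∂z_i∂z_j)` of a form `f`. -/
def hess (n : ℕ) (f : MvPolynomial (Fin n) ℂ) : MvPolynomial (Fin n) ℂ :=
  Matrix.det (Matrix.of fun i j : Fin n => pderiv i (pderiv j f))

/-- `μ` is the system of coefficients defining the associated form of `f`: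
for each multi-index `m` with `|m| = n(d-2)`, the scalar `μ m` satisfies
`z^m - μ m · Hess f ∈ (f_{z_1},…,f_{z_n})`. -/
def IsAssocCoeffs (n d : ℕ) (f : MvPolynomial (Fin n) ℂ) (μ : (Fin n → ℕ) → ℂ) : Prop :=
  ∀ m : Fin n → ℕ, (∑ i, m i) = n * (d - 2) →
    (∏ i, X i ^ m i) - C (μ m) * hess n f ∈ gradIdeal n f

/-- The associated form `Σ_{|m| = n(d-2)} (n(d-2))!/(m_1!⋯m_n!) · μ m · e^m`
built from the coefficients `μ`. -/
def assocForm (n d : ℕ) (μ : (Fin n → ℕ) → ℂ) : MvPolynomial (Fin n) ℂ :=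
  ∑ m ∈ Finset.Nat.antidiagonalTuple n (n * (d - 2)),
    C ((Nat.multinomial Finset.univ m : ℂ) * μ m) * ∏ i, X i ^ m i

end

/-- The monomial with exponent tuple `v`, as a `monomial`. -/
theorem prod_X_pow_eq_monomial_ofFun (v : Fin 3 → ℕ) :
    (∏ i, X i ^ v i : MvPolynomial (Fin 3) ℂ) =
      monomial (Finsupp.equivFunOnFinite.symm v) 1 := by
  rw [monomial_eq, Finsupp.prod_fintype _ _ (fun i => pow_zero _)]
  simp

theorem coeff_mul_C_mul_prod_X_pow (u v : Fin 3 → ℕ) (r : ℂ) (p : MvPolynomial (Fin 3) ℂ) :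
    coeff (Finsupp.equivFunOnFinite.symm u) (p * (C r * ∏ i, X i ^ v i)) =
      if ∀ i, v i ≤ u i then coeff (Finsupp.equivFunOnFinite.symm (u - v)) p * r else 0 := by
  rw [prod_X_pow_eq_monomial_ofFun, C_mul_monomial, mul_one, coeff_mul_monomial']
  have hsub : Finsupp.equivFunOnFinite.symm u - Finsupp.equivFunOnFinite.symm v =
      Finsupp.equivFunOnFinite.symm (u - v) := by
    ext i
    simp
  rw [hsub]
  exact if_congr Iff.rfl rfl rfl

/-- The values on cubic monomials of the functional `cubicFunctional`. -/
noncomputable def cubicWeight (a b c d : ℂ) (m : Fin 3 → ℕ) : ℂ :=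
  if m = ![3, 0, 0] then -2 * d * (b * c)
  else if m = ![0, 3, 0] then -2 * d * (a * c)
  else if m = ![0, 0, 3] then -2 * d * (a * b)
  else if m = ![1, 1, 1] then a * b * c
  else 0

/-- A linear functional on cubics that annihilates the gradient ideal of
`a z₁³ + b z₂³ + c z₃³ + 6d z₁z₂z₃`. -/
noncomputable def cubicFunctional (a b c d : ℂ) : MvPolynomial (Fin 3) ℂ →ₗ[ℂ] ℂ :=
  (-2 * d * (b * c)) • lcoeff ℂ (Finsupp.equivFunOnFinite.symm ![3, 0, 0])
    + (-2 * d * (a * c)) • lcoeff ℂ (Finsupp.equivFunOnFinite.symm ![0, 3, 0])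
    + (-2 * d * (a * b)) • lcoeff ℂ (Finsupp.equivFunOnFinite.symm ![0, 0, 3])
    + (a * b * c) • lcoeff ℂ (Finsupp.equivFunOnFinite.symm ![1, 1, 1])

theorem cubicFunctional_apply (a b c d : ℂ) (p : MvPolynomial (Fin 3) ℂ) :
    cubicFunctional a b c d p =
      -2 * d * (b * c) * coeff (Finsupp.equivFunOnFinite.symm ![3, 0, 0]) p
        + -2 * d * (a * c) * coeff (Finsupp.equivFunOnFinite.symm ![0, 3, 0]) p
        + -2 * d * (a * b) * coeff (Finsupp.equivFunOnFinite.symm ![0, 0, 3]) p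
        + a * b * c * coeff (Finsupp.equivFunOnFinite.symm ![1, 1, 1]) p := by
  simp [cubicFunctional]

theorem cubicFunctional_prod_X_pow (a b c d : ℂ) (m : Fin 3 → ℕ) :
    cubicFunctional a b c d (∏ i, X i ^ m i) = cubicWeight a b c d m := by
  rw [prod_X_pow_eq_monomial_ofFun, cubicFunctional_apply]
  simp only [coeff_monomial, EmbeddingLike.apply_eq_iff_eq, cubicWeight]
  split_ifs <;> simp_all

/-- The cubic `a z₁³ + b z₂³ + c z₃³ + 6d z₁z₂z₃`. -/
noncomputable def hesseCubic (a b c d : ℂ) : MvPolynomial (Fin 3) ℂ :=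
  C a * X 0 ^ 3 + C b * X 1 ^ 3 + C c * X 2 ^ 3 + C (6 * d) * (X 0 * X 1 * X 2)

theorem pderiv_hesseCubic (a b c d : ℂ) (i : Fin 3) :
    pderiv i (hesseCubic a b c d) =
      ![C (3 * a) * ∏ j, X j ^ (![2, 0, 0] : Fin 3 → ℕ) j
          + C (6 * d) * ∏ j, X j ^ (![0, 1, 1] : Fin 3 → ℕ) j,
        C (3 * b) * ∏ j, X j ^ (![0, 2, 0] : Fin 3 → ℕ) j
          + C (6 * d) * ∏ j, X j ^ (![1, 0, 1] : Fin 3 → ℕ) j,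
        C (3 * c) * ∏ j, X j ^ (![0, 0, 2] : Fin 3 → ℕ) j
          + C (6 * d) * ∏ j, X j ^ (![1, 1, 0] : Fin 3 → ℕ) j] i := by
  have h3 : (C 3 : MvPolynomial (Fin 3) ℂ) = 3 := rfl
  fin_cases i <;>
    simp [hesseCubic, pderiv_X, h3, Fin.prod_univ_three, Derivation.leibniz,
      Derivation.leibniz_pow] <;> ring

theorem hess_hesseCubic (a b c d : ℂ) :
    hess 3 (hesseCubic a b c d) =
      C (216 * (a * b * c + 2 * d ^ 3)) * ∏ j, X j ^ (![1, 1, 1] : Fin 3 → ℕ) j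
        + C (-216 * d ^ 2 * a) * ∏ j, X j ^ (![3, 0, 0] : Fin 3 → ℕ) j
        + C (-216 * d ^ 2 * b) * ∏ j, X j ^ (![0, 3, 0] : Fin 3 → ℕ) j
        + C (-216 * d ^ 2 * c) * ∏ j, X j ^ (![0, 0, 3] : Fin 3 → ℕ) j := by
  have h6 : (C 6 : MvPolynomial (Fin 3) ℂ) = 6 := rfl
  have h3 : (C 3 : MvPolynomial (Fin 3) ℂ) = 3 := rfl
  have h2 : (C 2 : MvPolynomial (Fin 3) ℂ) = 2 := rfl
  have h216 : (C 216 : MvPolynomial (Fin 3) ℂ) = 216 := rfl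
  simp only [hess, Matrix.det_fin_three, Matrix.of_apply, pderiv_hesseCubic]
  simp [pderiv_X, Fin.prod_univ_three, Derivation.leibniz, Derivation.leibniz_pow]
  simp only [h6, h3, h2, h216]
  ring

theorem cubicFunctional_hess (a b c d : ℂ) :
    cubicFunctional a b c d (hess 3 (hesseCubic a b c d)) =
      216 * (a * b * c) * (a * b * c + 8 * d ^ 3) := by
  simp only [hess_hesseCubic, C_mul', map_add, map_smul, cubicFunctional_prod_X_pow, smul_eq_mul]
  simp [cubicWeight]
  ring

theorem cubicFunctional_eq_zero_of_mem_gradIdeal (a b c d : ℂ) {g : MvPolynomial (Fin 3) ℂ}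
    (hg : g ∈ gradIdeal 3 (hesseCubic a b c d)) : cubicFunctional a b c d g = 0 := by
  obtain ⟨h, rfl⟩ := (Ideal.mem_span_range_iff_exists_fun).1 hg
  rw [map_sum]
  refine Finset.sum_eq_zero fun i _ => ?_
  rw [pderiv_hesseCubic]
  fin_cases i <;>
    simp [cubicFunctional_apply, mul_add, coeff_mul_C_mul_prod_X_pow, Fin.forall_fin_succ,
      -C_mul, -map_mul] <;> ring

/-- The coefficients of the associated form, cleared of denominators. -/
theorem IsAssocCoeffs.mul_eq_cubicWeight {a b c d : ℂ} {μ : (Fin 3 → ℕ) → ℂ}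
    (hμ : IsAssocCoeffs 3 3 (hesseCubic a b c d) μ) {m : Fin 3 → ℕ} (hm : ∑ i, m i = 3) :
    216 * (a * b * c) * (a * b * c + 8 * d ^ 3) * μ m = cubicWeight a b c d m := by
  have h := cubicFunctional_eq_zero_of_mem_gradIdeal a b c d (hμ m hm)
  rw [map_sub, C_mul', map_smul, cubicFunctional_prod_X_pow, cubicFunctional_hess,
    smul_eq_mul] at h
  linear_combination -h

theorem antidiagonalTuple_three_three : Finset.Nat.antidiagonalTuple 3 3 =
    {![3, 0, 0], ![0, 3, 0], ![0, 0, 3], ![1, 1, 1], ![2, 1, 0], ![2, 0, 1], ![1, 2, 0],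
      ![0, 2, 1], ![1, 0, 2], ![0, 1, 2]} := by
  decide

theorem sum_antidiagonalTuple_cubicWeight (a b c d k : ℂ) :
    ∑ m ∈ Finset.Nat.antidiagonalTuple 3 3,
      C ((Nat.multinomial Finset.univ m : ℂ) * (k * cubicWeight a b c d m)) * ∏ i, X i ^ m i =
    C (k * (-2 * d * (b * c))) * X 0 ^ 3 + (C (k * (-2 * d * (a * c))) * X 1 ^ 3
      + (C (k * (-2 * d * (a * b))) * X 2 ^ 3
        + C (6 * (k * (a * b * c))) * (X 0 * X 1 * X 2 : MvPolynomial (Fin 3) ℂ))) := by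
  have h₁ : Nat.multinomial Finset.univ ![3, 0, 0] = 1 := by decide
  have h₂ : Nat.multinomial Finset.univ ![0, 3, 0] = 1 := by decide
  have h₃ : Nat.multinomial Finset.univ ![0, 0, 3] = 1 := by decide
  have h₄ : Nat.multinomial Finset.univ ![1, 1, 1] = 6 := by decide
  rw [antidiagonalTuple_three_three]
  simp [cubicWeight, h₁, h₂, h₃, h₄, Fin.prod_univ_three, -C_mul, -map_mul]

/-- Collecting coefficients in a combination of two cubics in the span of
`x e₁³ + y e₂³ + z e₃³` and `e₁e₂e₃`. -/
theorem C_mul_add_C_mul_hesse_pencil (A B p q r s x y z : ℂ) :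
    C A * (C p * (C x * X 0 ^ 3 + C y * X 1 ^ 3 + C z * X 2 ^ 3) - C q * (X 0 * X 1 * X 2))
      + C B * (C r * (C x * X 0 ^ 3 + C y * X 1 ^ 3 + C z * X 2 ^ 3) - C s * (X 0 * X 1 * X 2)) =
    C ((A * p + B * r) * x) * X 0 ^ 3 + (C ((A * p + B * r) * y) * X 1 ^ 3
      + (C ((A * p + B * r) * z) * X 2 ^ 3
        + C (-(A * q + B * s)) * (X 0 * X 1 * X 2 : MvPolynomial (Fin 3) ℂ))) := by
  simp only [C_mul, C_add, C_neg]
  ring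

/-- For a nondegenerate ternary cubic
`f = a z_1³ + b z_2³ + c z_3³ + 6d z_1z_2z_3`, with the Aronhold invariants
`A₄ = abcd - d⁴`, `A₆ = a²b²c² - 20abcd³ - 8d⁶`, the discriminant `Δ = A₆² + 64A₄³`, the
Pippian `P` and the Quippian `Q` as displayed, the associated form `𝐟` of `f` satisfies
`Δ·𝐟 = -(1/36)A₆·P - (1/27)A₄·Q`. -/
theorem ternary_cubic_contravariant_identity
    (a b c d : ℂ) :
    letI f : MvPolynomial (Fin 3) ℂ :=
      C a * X 0 ^ 3 + C b * X 1 ^ 3 + C c * X 2 ^ 3 + C (6 * d) * (X 0 * X 1 * X 2)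
    letI A4 : ℂ := a * b * c * d - d ^ 4
    letI A6 : ℂ := a ^ 2 * b ^ 2 * c ^ 2 - 20 * a * b * c * d ^ 3 - 8 * d ^ 6
    letI Δ : ℂ := A6 ^ 2 + 64 * A4 ^ 3
    letI P : MvPolynomial (Fin 3) ℂ :=
      C (-d) * (C (b * c) * X 0 ^ 3 + C (a * c) * X 1 ^ 3 + C (a * b) * X 2 ^ 3)
        - C (a * b * c - 4 * d ^ 3) * (X 0 * X 1 * X 2)
    letI Q : MvPolynomial (Fin 3) ℂ :=
      C (a * b * c - 10 * d ^ 3)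
          * (C (b * c) * X 0 ^ 3 + C (a * c) * X 1 ^ 3 + C (a * b) * X 2 ^ 3)
        - C (6 * d ^ 2 * (5 * a * b * c + 4 * d ^ 3)) * (X 0 * X 1 * X 2)
    (∀ p : Fin 3 → ℂ, (∀ i, eval p (pderiv i f) = 0) → p = 0) →
      ∀ μ : (Fin 3 → ℕ) → ℂ, IsAssocCoeffs 3 3 f μ →
        C Δ * assocForm 3 3 μ = C (-(A6 / 36)) * P + C (-(A4 / 27)) * Q := by
  intro _ μ hμ
  have hcubic : IsAssocCoeffs 3 3 (hesseCubic a b c d) μ := hμ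
  have key : ∀ m ∈ Finset.Nat.antidiagonalTuple 3 3,
      C ((a ^ 2 * b ^ 2 * c ^ 2 - 20 * a * b * c * d ^ 3 - 8 * d ^ 6) ^ 2
          + 64 * (a * b * c * d - d ^ 4) ^ 3)
        * (C ((Nat.multinomial Finset.univ m : ℂ) * μ m) * ∏ i, X i ^ m i) =
      C ((Nat.multinomial Finset.univ m : ℂ) * ((a * b * c + 8 * d ^ 3) ^ 2 / 216
          * cubicWeight a b c d m)) * (∏ i, X i ^ m i : MvPolynomial (Fin 3) ℂ) := by
    intro m hm
    rw [← hcubic.mul_eq_cubicWeight (Finset.Nat.mem_antidiagonalTuple.1 hm), ← mul_assoc, ← C_mul]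
    congr 2
    ring
  rw [assocForm, Finset.mul_sum, Finset.sum_congr rfl key, sum_antidiagonalTuple_cubicWeight,
    C_mul_add_C_mul_hesse_pencil]
  refine congrArg₂ _ ?_ (congrArg₂ _ ?_ (congrArg₂ _ ?_ ?_)) <;> congr 2 <;> ring
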